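/- Assume condition (C) and fix β ∈ (0,1) and γ ≠ 0. Then there exists a β-discount optimal Markov policy that is ultimately stationary: there exist N ∈ ℕ and functions u_0, u_1, …, u_{N-1}, u : E → U such that the Markov policy π = (u_0, u_1, …, u_{N-1}, u, u, …) satisfies J_γ(x,π;β) = sup_{π'∈Π} J_γ(x,π';β) for every x ∈ E. -/

import Mathlib

open Filter Real

/-- A (history-dependent) policy: at time `n`, the action is a function of `(X_0, …, X_n)`. -/
abbrev Policy (E U : Type*) : Type _ := ∀ n : ℕ, (Fin (n + 1) → E) → U

/-- The stationary Markov policy induced by `u : E → U`. -/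
def stationaryPolicy {E U : Type*} (u : E → U) : Policy E U :=
  fun n h => u (h (Fin.last n))

/-- The Markov policy induced by a sequence `u : ℕ → E → U`. -/
def markovPolicy {E U : Type*} (u : ℕ → E → U) : Policy E U :=
  fun n h => u n (h (Fin.last n))

/-- The action taken at time `i` by policy `pol` along the path `ω = (x_0, …, x_n)`. -/
def act {E U : Type*} (pol : Policy E U) {n : ℕ} (ω : Fin (n + 1) → E) (i : Fin n) : U :=
  pol i.1 (fun j => ω (Fin.castLE (Nat.succ_le_succ i.2.le) j))

/-- Probability of the path `ω = (x_0, …, x_n)` under policy `pol` started at `x`: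
`∏_{i=0}^{n-1} P^{a_i}(x_i, x_{i+1})` if `x_0 = x`, and `0` otherwise. -/
def pathProb {E U : Type*} [DecidableEq E] (P : U → E → E → ℝ) (pol : Policy E U)
    (x : E) (n : ℕ) (ω : Fin (n + 1) → E) : ℝ :=
  (if ω 0 = x then 1 else 0) * ∏ i : Fin n, P (act pol ω i) (ω i.castSucc) (ω i.succ)

/-- Expectation `E_x^pol[f(X_0, …, X_n)]`. -/
noncomputable def expVal {E U : Type*} [Fintype E] [DecidableEq E]
    (P : U → E → E → ℝ) (pol : Policy E U) (x : E) (n : ℕ)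
    (f : (Fin (n + 1) → E) → ℝ) : ℝ :=
  ∑ ω : Fin (n + 1) → E, pathProb P pol x n ω * f ω

/-- The (possibly discounted) cumulative reward `Σ_{i=0}^{n-1} d i * c(X_i, a_i)` along `ω`. -/
def rewSum {E U : Type*} (c : E → U → ℝ) (pol : Policy E U) (d : ℕ → ℝ) (n : ℕ)
    (ω : Fin (n + 1) → E) : ℝ :=
  ∑ i : Fin n, d i.1 * c (ω i.castSucc) (act pol ω i)

/-- Long-run risk-sensitive averaged criterion `J_γ(x, pol)`. -/
noncomputable def Javg {E U : Type*} [Fintype E] [DecidableEq E]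
    (P : U → E → E → ℝ) (c : E → U → ℝ) (γ : ℝ) (x : E) (pol : Policy E U) : ℝ :=
  if γ = 0 then
    liminf (fun n : ℕ =>
      (1 / (n : ℝ)) * expVal P pol x n (rewSum c pol (fun _ => 1) n)) atTop
  else
    liminf (fun n : ℕ =>
      (1 / ((n : ℝ) * γ)) * Real.log (expVal P pol x n
        (fun ω => Real.exp (γ * rewSum c pol (fun _ => 1) n ω)))) atTop

/-- Discounted risk-sensitive criterion `J_γ(x, pol; β)`. -/
noncomputable def Jdisc {E U : Type*} [Fintype E] [DecidableEq E]
    (P : U → E → E → ℝ) (c : E → U → ℝ) (γ : ℝ) (x : E) (pol : Policy E U) (β : ℝ) : ℝ :=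
  if γ = 0 then
    limUnder atTop (fun n : ℕ => expVal P pol x n (rewSum c pol (fun i => β ^ i) n))
  else
    (1 / γ) * Real.log (limUnder atTop (fun n : ℕ =>
      expVal P pol x n (fun ω => Real.exp (γ * rewSum c pol (fun i => β ^ i) n ω))))

/-- Row-stochasticity of the family of transition matrices `(P^a)_{a ∈ U}`. -/
def IsStochastic {E U : Type*} [Fintype E] (P : U → E → E → ℝ) : Prop :=
  (∀ a x y, 0 ≤ P a x y) ∧ ∀ a x, ∑ y, P a x y = 1

/-- Condition (C): strong uniform mixing, `min_{a} min_{x,y} P^a(x,y) > 0`. -/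
def CondC {E U : Type*} (P : U → E → E → ℝ) : Prop :=
  ∀ a x y, 0 < P a x y

/-- `w` solves the risk-sensitive discounted Bellman equation for discount `β`. -/
def IsBellmanSol {E U : Type*} [Fintype E] [Fintype U]
    (P : U → E → E → ℝ) (c : E → U → ℝ) (β : ℝ) (w : E → ℝ → ℝ) : Prop :=
  ∀ x : E, ∀ γ : ℝ, γ ≠ 0 →
    w x γ = ⨆ a : U, (c x a + (1 / γ) * Real.log (∑ y, Real.exp (w y (β * γ)) * P a x y))

section PathExpectation

variable {E U : Type*} {P : U → E → E → ℝ} {pol : Policy E U} {x : E} {n : ℕ}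

lemma act_snoc_castSucc (ω : Fin (n + 1) → E) (y : E) (i : Fin n) :
    act pol (Fin.snoc ω y : Fin (n + 1 + 1) → E) i.castSucc = act pol ω i := by
  unfold act
  congr 1
  funext j
  exact Fin.snoc_castSucc (α := fun _ => E) y ω (Fin.castLE (Nat.succ_le_succ i.2.le) j)

lemma act_snoc_last (ω : Fin (n + 1) → E) (y : E) :
    act pol (Fin.snoc ω y : Fin (n + 1 + 1) → E) (Fin.last n) = pol n ω := by
  unfold act
  congr 1
  funext j
  exact Fin.snoc_castSucc (α := fun _ => E) y ω j

lemma rewSum_snoc (c : E → U → ℝ) (d : ℕ → ℝ) (ω : Fin (n + 1) → E) (y : E) :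
    rewSum c pol d (n + 1) (Fin.snoc ω y) =
      rewSum c pol d n ω + d n * c (ω (Fin.last n)) (pol n ω) := by
  unfold rewSum
  rw [Fin.sum_univ_castSucc, act_snoc_last]
  simp only [act_snoc_castSucc, Fin.snoc_castSucc, Fin.val_castSucc, Fin.val_last]

lemma pathProb_snoc [DecidableEq E] (ω : Fin (n + 1) → E) (y : E) :
    pathProb P pol x (n + 1) (Fin.snoc ω y) =
      pathProb P pol x n ω * P (pol n ω) (ω (Fin.last n)) y := by
  unfold pathProb
  have h0 : (Fin.snoc ω y : Fin (n + 1 + 1) → E) 0 = ω 0 :=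
    Fin.snoc_castSucc (α := fun _ => E) y ω 0
  rw [Fin.prod_univ_castSucc, h0, act_snoc_last]
  simp only [act_snoc_castSucc, Fin.snoc_castSucc, Fin.succ_last, Fin.snoc_last,
    Fin.succ_castSucc, mul_assoc]

variable [Fintype E] [DecidableEq E]

lemma pathProb_nonneg (hP : IsStochastic P) (ω : Fin (n + 1) → E) :
    0 ≤ pathProb P pol x n ω := by
  unfold pathProb
  exact mul_nonneg (by split_ifs <;> norm_num) (Finset.prod_nonneg fun i _ => hP.1 _ _ _)

lemma expVal_mono (hP : IsStochastic P) {f g : (Fin (n + 1) → E) → ℝ} (h : ∀ ω, f ω ≤ g ω) :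
    expVal P pol x n f ≤ expVal P pol x n g :=
  Finset.sum_le_sum fun ω _ => mul_le_mul_of_nonneg_left (h ω) (pathProb_nonneg hP ω)

lemma mul_expVal (s : ℝ) (f : (Fin (n + 1) → E) → ℝ) :
    s * expVal P pol x n f = expVal P pol x n fun ω => s * f ω := by
  unfold expVal
  rw [Finset.mul_sum]
  exact Finset.sum_congr rfl fun ω _ => by ring

lemma expVal_sub (f g : (Fin (n + 1) → E) → ℝ) :
    expVal P pol x n f - expVal P pol x n g = expVal P pol x n fun ω => f ω - g ω := by
  unfold expVal
  rw [← Finset.sum_sub_distrib]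
  exact Finset.sum_congr rfl fun ω _ => by ring

/-- Conditioning on the first `n` steps. -/
lemma expVal_succ (f : (Fin (n + 1 + 1) → E) → ℝ) :
    expVal P pol x (n + 1) f =
      expVal P pol x n fun ω => ∑ y, P (pol n ω) (ω (Fin.last n)) y * f (Fin.snoc ω y) := by
  unfold expVal
  rw [← (Fin.snocEquiv fun _ => E).sum_comp, Fintype.sum_prod_type_right]
  refine Finset.sum_congr rfl fun ω _ => ?_
  rw [Finset.mul_sum]
  refine Finset.sum_congr rfl fun y _ => ?_
  have h : (Fin.snocEquiv fun _ => E) (y, ω) = Fin.snoc ω y := rfl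
  rw [h, pathProb_snoc, mul_assoc]

lemma expVal_const (hP : IsStochastic P) (b : ℝ) : expVal P pol x n (fun _ => b) = b := by
  induction n with
  | zero =>
    unfold expVal
    rw [← (Equiv.funUnique (Fin 1) E).symm.sum_comp]
    simp [pathProb]
  | succ n ih =>
    rw [expVal_succ]
    simpa only [← Finset.sum_mul, hP.2, one_mul] using ih

lemma abs_expVal_le (hP : IsStochastic P) {f : (Fin (n + 1) → E) → ℝ} {b : ℝ}
    (h : ∀ ω, |f ω| ≤ b) : |expVal P pol x n f| ≤ b := by
  rw [abs_le]
  constructor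
  · exact (expVal_const hP (-b)).symm.le.trans (expVal_mono hP fun ω => (abs_le.1 (h ω)).1)
  · exact (expVal_mono hP fun ω => (abs_le.1 (h ω)).2).trans (expVal_const hP b).le

/-- One step of the exponential cumulative reward weighted by a terminal value. -/
lemma expVal_exp_rewSum_succ (c : E → U → ℝ) (d : ℕ → ℝ) (γ : ℝ) (v : E → ℝ) :
    expVal P pol x (n + 1)
        (fun ω => exp (γ * rewSum c pol d (n + 1) ω) * v (ω (Fin.last (n + 1)))) =
      expVal P pol x n fun ω => exp (γ * rewSum c pol d n ω) *
        (exp (d n * (γ * c (ω (Fin.last n)) (pol n ω))) *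
          ∑ y, P (pol n ω) (ω (Fin.last n)) y * v y) := by
  rw [expVal_succ]
  congr 1
  funext ω
  rw [← mul_assoc, ← exp_add, Finset.mul_sum]
  refine Finset.sum_congr rfl fun y _ => ?_
  rw [rewSum_snoc, Fin.snoc_last]
  ring_nf

end PathExpectation

lemma abs_exp_sub_one_le_abs_mul_exp (y : ℝ) : |exp y - 1| ≤ |y| * exp |y| := by
  have h1 := add_one_le_exp y
  have h2 : exp y - 1 ≤ y * exp y := by
    have := mul_le_mul_of_nonneg_right (add_one_le_exp (-y)) (exp_pos y).le
    rw [← exp_add, neg_add_cancel, exp_zero] at this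
    linarith
  have h3 : y * exp y ≤ |y| * exp |y| :=
    mul_le_mul (le_abs_self y) (exp_le_exp.2 (le_abs_self y)) (exp_pos _).le (abs_nonneg y)
  have h4 : |y| ≤ |y| * exp |y| :=
    le_mul_of_one_le_right (abs_nonneg y) (one_le_exp (abs_nonneg y))
  rw [abs_le]
  exact ⟨by linarith [neg_abs_le y], by linarith⟩

section Discounted

variable {E U : Type*} {P : U → E → E → ℝ} {pol : Policy E U} {x : E} {c : E → U → ℝ} {β γ M : ℝ}

lemma abs_mul_rewSum_le (hβ : β ∈ Set.Ioo (0 : ℝ) 1) (hM : ∀ x a, |γ * c x a| ≤ M) (n : ℕ)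
    (ω : Fin (n + 1) → E) : |γ * rewSum c pol (fun i => β ^ i) n ω| ≤ M * (1 - β)⁻¹ := by
  have hM0 : 0 ≤ M := by
    have h : Nonempty U := ⟨pol n ω⟩
    exact (abs_nonneg _).trans (hM (ω 0) h.some)
  unfold rewSum
  rw [Finset.mul_sum]
  refine (Finset.abs_sum_le_sum_abs _ _).trans ?_
  calc ∑ i : Fin n, |γ * (β ^ (i : ℕ) * c (ω i.castSucc) (act pol ω i))|
      ≤ ∑ i : Fin n, M * β ^ (i : ℕ) := by
        refine Finset.sum_le_sum fun i _ => ?_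
        rw [mul_left_comm, abs_mul, abs_of_pos (pow_pos hβ.1 _), mul_comm]
        exact mul_le_mul_of_nonneg_right (hM _ _) (pow_pos hβ.1 _).le
    _ = M * ∑ i ∈ Finset.range n, β ^ i := by
        rw [Fin.sum_univ_eq_sum_range (fun i => M * β ^ i), Finset.mul_sum]
    _ ≤ M * (1 - β)⁻¹ := by
        refine mul_le_mul_of_nonneg_left ?_ hM0
        rw [← tsum_geometric_of_lt_one hβ.1.le hβ.2]
        exact (summable_geometric_of_lt_one hβ.1.le hβ.2).sum_le_tsum _
          fun i _ => (pow_pos hβ.1 i).le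

variable [Fintype E] [DecidableEq E]

/-- The discounted exponential expectation converges, and its limit is bounded away from `0` and
`∞` uniformly in the policy. -/
lemma exists_tendsto_expVal_exp (hP : IsStochastic P) (hβ : β ∈ Set.Ioo (0 : ℝ) 1)
    (hM : ∀ x a, |γ * c x a| ≤ M) (pol : Policy E U) (x : E) :
    ∃ L : ℝ, exp (-(M * (1 - β)⁻¹)) ≤ L ∧ L ≤ exp (M * (1 - β)⁻¹) ∧
      Tendsto (fun n => expVal P pol x n
        fun ω => exp (γ * rewSum c pol (fun i => β ^ i) n ω)) atTop (nhds L) := by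
  set W : ℕ → ℝ := fun n => expVal P pol x n
    fun ω => exp (γ * rewSum c pol (fun i => β ^ i) n ω) with hW
  have hM0 : 0 ≤ M := (abs_nonneg _).trans (hM x (pol 0 fun _ => x))
  have hcauchy : CauchySeq W := by
    refine cauchySeq_of_le_geometric β (exp (M * (1 - β)⁻¹) * (M * exp M)) hβ.2 fun n => ?_
    have hsucc := expVal_exp_rewSum_succ (P := P) (pol := pol) (x := x) (n := n) c
      (fun i => β ^ i) γ fun _ => 1
    simp only [mul_one, hP.2] at hsucc
    rw [dist_comm, Real.dist_eq, hW]
    simp only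
    rw [hsucc, expVal_sub]
    refine abs_expVal_le hP fun ω => ?_
    rw [← mul_sub_one, abs_mul, abs_of_pos (exp_pos _), mul_assoc]
    have hb : β ^ n ≤ 1 := pow_le_one₀ hβ.1.le hβ.2.le
    have hb0 : 0 < β ^ n := pow_pos hβ.1 n
    have hy : |β ^ n * (γ * c (ω (Fin.last n)) (pol n ω))| ≤ β ^ n * M := by
      rw [abs_mul, abs_of_pos hb0]
      exact mul_le_mul_of_nonneg_left (hM _ _) hb0.le
    refine mul_le_mul (exp_le_exp.2 (abs_le.1 (abs_mul_rewSum_le hβ hM n ω)).2) ?_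
      (abs_nonneg _) (exp_pos _).le
    refine (abs_exp_sub_one_le_abs_mul_exp _).trans ?_
    calc _ ≤ (β ^ n * M) * exp M := by
          gcongr
          exact hy.trans (mul_le_of_le_one_left hM0 hb)
      _ = M * exp M * β ^ n := by ring
  obtain ⟨L, hL⟩ := cauchySeq_tendsto_of_complete hcauchy
  refine ⟨L, ge_of_tendsto' hL fun n => ?_, le_of_tendsto' hL fun n => ?_, hL⟩
  · exact (expVal_const hP _).symm.le.trans
      (expVal_mono hP fun ω => exp_le_exp.2 (abs_le.1 (abs_mul_rewSum_le hβ hM n ω)).1)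
  · exact (expVal_mono hP fun ω =>
      exp_le_exp.2 (abs_le.1 (abs_mul_rewSum_le hβ hM n ω)).2).trans (expVal_const hP _).le

lemma expVal_zero_exp_rewSum_mul (c : E → U → ℝ) (d : ℕ → ℝ) (v : E → ℝ) :
    expVal P pol x 0 (fun ω => exp (γ * rewSum c pol d 0 ω) * v (ω (Fin.last 0))) = v x := by
  unfold expVal
  rw [← (Equiv.funUnique (Fin 1) E).symm.sum_comp]
  simp [pathProb, rewSum]

/-- Terminal values converging to `1` do not change the limit. -/
lemma tendsto_expVal_exp_mul (hP : IsStochastic P) (hβ : β ∈ Set.Ioo (0 : ℝ) 1)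
    (hM : ∀ x a, |γ * c x a| ≤ M) {V : ℕ → E → ℝ}
    (hV : ∀ x, Tendsto (fun n => V n x) atTop (nhds 1)) {L : ℝ}
    (hL : Tendsto (fun n => expVal P pol x n
        fun ω => exp (γ * rewSum c pol (fun i => β ^ i) n ω)) atTop (nhds L)) :
    Tendsto (fun n => expVal P pol x n
      fun ω => exp (γ * rewSum c pol (fun i => β ^ i) n ω) * V n (ω (Fin.last n)))
      atTop (nhds L) := by
  have hsum : Tendsto (fun n => exp (M * (1 - β)⁻¹) * ∑ y, |V n y - 1|) atTop (nhds 0) := by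
    have h : Tendsto (fun n => ∑ y, |V n y - 1|) atTop (nhds (∑ _y : E, 0)) := by
      refine tendsto_finsetSum _ fun y _ => ?_
      simpa using ((hV y).sub_const 1).abs
    simpa using h.const_mul (exp (M * (1 - β)⁻¹))
  have hdiff := squeeze_zero_norm (f := fun n =>
      expVal P pol x n
        (fun ω => exp (γ * rewSum c pol (fun i => β ^ i) n ω) * V n (ω (Fin.last n))) -
      expVal P pol x n fun ω => exp (γ * rewSum c pol (fun i => β ^ i) n ω)) (fun n => by
    rw [expVal_sub, Real.norm_eq_abs]
    refine abs_expVal_le hP fun ω => ?_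
    rw [← mul_sub_one, abs_mul, abs_of_pos (exp_pos _)]
    exact mul_le_mul (exp_le_exp.2 (abs_le.1 (abs_mul_rewSum_le hβ hM n ω)).2)
      (Finset.single_le_sum (f := fun y => |V n y - 1|) (fun y _ => abs_nonneg _)
        (Finset.mem_univ _)) (abs_nonneg _) (exp_pos _).le) hsum
  simpa using hdiff.add hL

/-- A supersolution of the Bellman recursion (in the direction given by the sign of `s`)
dominates every policy. -/
lemma mul_limit_le_of_bellman (hP : IsStochastic P) (hβ : β ∈ Set.Ioo (0 : ℝ) 1)
    (hM : ∀ x a, |γ * c x a| ≤ M) {V : ℕ → E → ℝ}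
    (hV : ∀ x, Tendsto (fun n => V n x) atTop (nhds 1)) {s : ℝ}
    (hB : ∀ n x a, s * (exp (β ^ n * (γ * c x a)) * ∑ y, P a x y * V (n + 1) y) ≤ s * V n x)
    {L : ℝ}
    (hL : Tendsto (fun n => expVal P pol x n
        fun ω => exp (γ * rewSum c pol (fun i => β ^ i) n ω)) atTop (nhds L)) :
    s * L ≤ s * V 0 x := by
  refine le_of_tendsto' ((tendsto_expVal_exp_mul hP hβ hM hV hL).const_mul s) fun n => ?_
  induction n with
  | zero => rw [expVal_zero_exp_rewSum_mul]
  | succ n ih =>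
    refine le_trans ?_ ih
    rw [expVal_exp_rewSum_succ, mul_expVal, mul_expVal]
    refine expVal_mono hP fun ω => ?_
    rw [mul_left_comm s (exp (γ * _)), mul_left_comm s (exp (γ * _))]
    exact mul_le_mul_of_nonneg_left (hB n _ _) (exp_pos _).le

/-- A Markov policy satisfying the Bellman recursion with value `V` has value `V 0`. -/
lemma limit_eq_of_bellman (hP : IsStochastic P) (hβ : β ∈ Set.Ioo (0 : ℝ) 1)
    (hM : ∀ x a, |γ * c x a| ≤ M) {V : ℕ → E → ℝ}
    (hV : ∀ x, Tendsto (fun n => V n x) atTop (nhds 1)) {us : ℕ → E → U}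
    (hB : ∀ n x, exp (β ^ n * (γ * c x (us n x))) * ∑ y, P (us n x) x y * V (n + 1) y = V n x)
    {L : ℝ}
    (hL : Tendsto (fun n => expVal P (markovPolicy us) x n
        fun ω => exp (γ * rewSum c (markovPolicy us) (fun i => β ^ i) n ω)) atTop (nhds L)) :
    L = V 0 x := by
  refine tendsto_nhds_unique (tendsto_expVal_exp_mul hP hβ hM hV hL) ?_
  refine tendsto_const_nhds.congr fun n => ?_
  induction n with
  | zero => rw [expVal_zero_exp_rewSum_mul]
  | succ n ih =>
    rw [ih, expVal_exp_rewSum_succ]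
    congr 1
    funext ω
    rw [← hB n]
    rfl

lemma Jdisc_eq (hγ : γ ≠ 0) {L : ℝ}
    (hL : Tendsto (fun n => expVal P pol x n
        fun ω => exp (γ * rewSum c pol (fun i => β ^ i) n ω)) atTop (nhds L)) :
    Jdisc P c γ x pol β = 1 / γ * log L := by
  unfold Jdisc
  rw [if_neg hγ, hL.limUnder_eq]

lemma one_div_mul_log_le (hγ : γ ≠ 0) {a b : ℝ} (ha : 0 < a) (hb : 0 < b)
    (h : γ * a ≤ γ * b) : 1 / γ * log a ≤ 1 / γ * log b := by
  rcases hγ.lt_or_gt with h0 | h0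
  · exact mul_le_mul_of_nonpos_left (log_le_log hb ((mul_le_mul_left_of_neg h0).1 h))
      (one_div_nonpos.2 h0.le)
  · exact mul_le_mul_of_nonneg_left (log_le_log ha (le_of_mul_le_mul_left h h0))
      (one_div_nonneg.2 h0.le)

/-- Verification theorem for the risk-sensitive discounted criterion. -/
lemma Jdisc_markovPolicy_eq_iSup [Fintype U] (hP : IsStochastic P)
    (hβ : β ∈ Set.Ioo (0 : ℝ) 1) (hγ : γ ≠ 0) {V : ℕ → E → ℝ}
    (hV : ∀ x, Tendsto (fun n => V n x) atTop (nhds 1))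
    (hB : ∀ n x a, γ * (exp (β ^ n * (γ * c x a)) * ∑ y, P a x y * V (n + 1) y) ≤ γ * V n x)
    {us : ℕ → E → U}
    (hus : ∀ n x,
      exp (β ^ n * (γ * c x (us n x))) * ∑ y, P (us n x) x y * V (n + 1) y = V n x) (x : E) :
    Jdisc P c γ x (markovPolicy us) β = ⨆ pol : Policy E U, Jdisc P c γ x pol β := by
  obtain ⟨M, hM'⟩ := (Set.finite_range fun q : E × U => |γ * c q.1 q.2|).bddAbove
  have hM : ∀ x a, |γ * c x a| ≤ M := fun x a => hM' ⟨(x, a), rfl⟩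
  have hle : ∀ pol : Policy E U, Jdisc P c γ x pol β ≤ Jdisc P c γ x (markovPolicy us) β := by
    intro pol
    obtain ⟨L, hL0, -, hL⟩ := exists_tendsto_expVal_exp hP hβ hM pol x
    obtain ⟨L', hL'0, -, hL'⟩ := exists_tendsto_expVal_exp hP hβ hM (markovPolicy us) x
    rw [Jdisc_eq hγ hL, Jdisc_eq hγ hL']
    refine one_div_mul_log_le hγ ((exp_pos _).trans_le hL0) ((exp_pos _).trans_le hL'0) ?_
    rw [limit_eq_of_bellman hP hβ hM hV hus hL']
    exact mul_limit_le_of_bellman hP hβ hM hV hB hL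
  have : Nonempty (Policy E U) := ⟨markovPolicy us⟩
  exact le_antisymm (le_ciSup (f := fun pol : Policy E U => Jdisc P c γ x pol β)
    ⟨_, Set.forall_mem_range.2 hle⟩ (markovPolicy us)) (ciSup_le hle)

end Discounted

lemma norm_exp_mul_ofReal_le {E : Type*} {r : E → ℝ} {M : ℝ} (hM : ∀ x, |r x| ≤ M)
    (z : ℂ) (x : E) :
    ‖Complex.exp (z * r x)‖ ≤ exp (M * ‖z‖) := by
  refine (Complex.norm_exp_le_exp_norm _).trans (exp_le_exp.2 ?_)
  rw [norm_mul, Complex.norm_real, Real.norm_eq_abs, mul_comm]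
  exact mul_le_mul_of_nonneg_right (hM x) (norm_nonneg z)

section StationaryValue

variable {E : Type*} [Fintype E]

/-- Value iterates `E_x exp (z ∑_{i < n} β ^ i r(X_i))` of a Markov chain with transition matrix
`p` and running reward `r`, as functions of a complex risk parameter `z`. -/
noncomputable def valueIter (p : E → E → ℝ) (r : E → ℝ) (β : ℝ) : ℕ → E → ℂ → ℂ
  | 0, _, _ => 1
  | n + 1, x, z => Complex.exp (z * r x) * ∑ y, (p x y : ℂ) * valueIter p r β n y (β * z)

variable {p : E → E → ℝ} {r : E → ℝ} {β M : ℝ}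

lemma differentiable_valueIter (n : ℕ) (x : E) : Differentiable ℂ (valueIter p r β n x) := by
  induction n generalizing x with
  | zero => exact differentiable_const 1
  | succ n ih =>
    have h : ∀ y, Differentiable ℂ fun z : ℂ => valueIter p r β n y (β * z) := fun y =>
      (ih y).comp (differentiable_id.const_mul _)
    simp only [valueIter]
    fun_prop

lemma valueIter_zero_right (hp : ∀ x, ∑ y, p x y = 1) (n : ℕ) (x : E) :
    valueIter p r β n x 0 = 1 := by
  induction n generalizing x with
  | zero => rfl
  | succ n ih =>
    simp only [valueIter, mul_zero, zero_mul, Complex.exp_zero, ih, mul_one, one_mul]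
    exact_mod_cast hp x

lemma norm_valueIter_succ_sub_le (hp0 : ∀ x y, 0 ≤ p x y) (hp : ∀ x, ∑ y, p x y = 1)
    (hβ : β ∈ Set.Ioo (0 : ℝ) 1) (hM : ∀ x, |r x| ≤ M) (n : ℕ) (x : E) (z : ℂ) :
    ‖valueIter p r β (n + 1) x z - valueIter p r β n x z‖ ≤
      M * ‖z‖ * exp (M * ‖z‖ / (1 - β)) * β ^ n := by
  have hM0 : 0 ≤ M := (abs_nonneg _).trans (hM x)
  have hβ' : 0 < 1 - β := sub_pos.2 hβ.2
  induction n generalizing x z with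
  | zero =>
    have h1 : (∑ y, (p x y : ℂ)) = 1 := by exact_mod_cast hp x
    have h2 := Complex.norm_exp_sub_sum_le_norm_mul_exp (z * r x) 1
    have h3 : ‖z * r x‖ ≤ M * ‖z‖ := by
      rw [norm_mul, Complex.norm_real, Real.norm_eq_abs, mul_comm]
      exact mul_le_mul_of_nonneg_right (hM x) (norm_nonneg z)
    have h4 : M * ‖z‖ ≤ M * ‖z‖ / (1 - β) :=
      le_div_self (by positivity) hβ' (by linarith [hβ.1])
    simp only [Finset.range_one, Finset.sum_singleton, pow_zero, Nat.factorial_zero, Nat.cast_one,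
      div_one, pow_one] at h2
    simp only [valueIter, mul_one, h1, pow_zero]
    refine h2.trans (mul_le_mul h3 (exp_le_exp.2 (h3.trans h4)) (exp_pos _).le (by positivity))
  | succ n ih =>
    have hstep : valueIter p r β (n + 1 + 1) x z - valueIter p r β (n + 1) x z =
        Complex.exp (z * r x) * ∑ y, (p x y : ℂ) *
          (valueIter p r β (n + 1) y (β * z) - valueIter p r β n y (β * z)) := by
      rw [valueIter, valueIter, ← mul_sub, ← Finset.sum_sub_distrib]
      simp only [mul_sub]
    have hz : ‖(β : ℂ) * z‖ = β * ‖z‖ := by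
      rw [norm_mul, Complex.norm_real, Real.norm_eq_abs, abs_of_pos hβ.1]
    set B := M * (β * ‖z‖) * exp (M * (β * ‖z‖) / (1 - β)) * β ^ n with hB
    have hsum : ‖∑ y, (p x y : ℂ) *
        (valueIter p r β (n + 1) y (β * z) - valueIter p r β n y (β * z))‖ ≤ B := by
      refine (norm_sum_le _ _).trans ?_
      calc _ ≤ ∑ y, p x y * B := by
            refine Finset.sum_le_sum fun y _ => ?_
            rw [norm_mul, Complex.norm_real, Real.norm_eq_abs, abs_of_nonneg (hp0 x y)]
            refine mul_le_mul_of_nonneg_left ?_ (hp0 x y)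
            have := ih y (β * z)
            rwa [hz] at this
        _ = B := by rw [← Finset.sum_mul, hp, one_mul]
    rw [hstep, norm_mul]
    refine (mul_le_mul (norm_exp_mul_ofReal_le hM z x) hsum (norm_nonneg _)
      (exp_pos _).le).trans_eq ?_
    have hexp : exp (M * ‖z‖ / (1 - β)) = exp (M * ‖z‖) * exp (M * (β * ‖z‖) / (1 - β)) := by
      rw [← exp_add]
      congr 1
      field_simp
      ring
    rw [hB, hexp]
    ring

/-- The discounted value of a stationary policy is analytic in the risk parameter near `0`. -/
lemma exists_analyticAt_stationaryValue (hp0 : ∀ x y, 0 ≤ p x y) (hp : ∀ x, ∑ y, p x y = 1)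
    (hβ : β ∈ Set.Ioo (0 : ℝ) 1) (r : E → ℝ) :
    ∃ f : E → ℝ → ℝ, (∀ x, AnalyticAt ℝ (f x) 0) ∧ (∀ x, f x 0 = 1) ∧
      ∀ x t, f x t = exp (t * r x) * ∑ y, p x y * f y (β * t) := by
  obtain ⟨M, hM'⟩ := (Set.finite_range fun x => |r x|).bddAbove
  have hM : ∀ x, |r x| ≤ M := fun x => hM' ⟨x, rfl⟩
  set D : E → ℕ → ℂ → ℂ := fun x n z => valueIter p r β (n + 1) x z - valueIter p r β n x z
    with hD
  have hDle := norm_valueIter_succ_sub_le hp0 hp hβ hM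
  have hgeom := summable_geometric_of_lt_one hβ.1.le hβ.2
  set F : E → ℂ → ℂ := fun x z => ∑' n, D x n z with hF
  have hlim : ∀ x z, Tendsto (fun n => valueIter p r β n x z) atTop (nhds (F x z + 1)) := by
    intro x z
    have hs : Summable fun n => D x n z :=
      Summable.of_norm_bounded (hgeom.mul_left _) fun n => hDle n x z
    have := hs.hasSum.tendsto_sum_nat.add_const 1
    refine this.congr fun n => ?_
    rw [hD, Finset.sum_range_sub fun n => valueIter p r β n x z]
    exact sub_add_cancel _ _
  have hfix : ∀ x z, F x z + 1 =
      Complex.exp (z * r x) * ∑ y, (p x y : ℂ) * (F y (β * z) + 1) := by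
    intro x z
    refine tendsto_nhds_unique ((tendsto_add_atTop_iff_nat 1).2 (hlim x z)) ?_
    simp only [valueIter]
    exact (tendsto_finsetSum _ fun y _ => (hlim y (β * z)).const_mul _).const_mul _
  have hdiff : ∀ x, DifferentiableOn ℂ (F x) (Metric.ball 0 1) := by
    intro x
    have hM0 : 0 ≤ M := (abs_nonneg _).trans (hM x)
    have hβ' : 0 < 1 - β := sub_pos.2 hβ.2
    refine Complex.differentiableOn_tsum_of_summable_norm
      (u := fun n => M * 1 * exp (M * 1 / (1 - β)) * β ^ n) (hgeom.mul_left _) (fun n =>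
        ((differentiable_valueIter _ _).sub (differentiable_valueIter _ _)).differentiableOn)
      Metric.isOpen_ball fun n z hz => (hDle n x z).trans ?_
    have hz' : ‖z‖ ≤ 1 := (mem_ball_zero_iff.1 hz).le
    have hβ0 := hβ.1
    gcongr
  have han : ∀ x, AnalyticAt ℂ (fun z => F x z + 1) ((0 : ℝ) : ℂ) := fun x => by
    rw [Complex.ofReal_zero]
    exact ((hdiff x).analyticAt (Metric.ball_mem_nhds 0 one_pos)).add analyticAt_const
  refine ⟨fun x t => (F x t + 1).re, fun x => (han x).re_ofReal, fun x => ?_, fun x t => ?_⟩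
  · simp [hF, hD, valueIter_zero_right hp]
  · have h1 : Complex.exp (t * r x) = (exp (t * r x) : ℝ) := by push_cast; rfl
    simp only
    rw [hfix x t, h1, Complex.re_ofReal_mul, Complex.re_sum]
    simp only [Complex.re_ofReal_mul, Complex.ofReal_mul]

end StationaryValue

/-- A real analytic function has constant sign immediately to the right of a point. -/
lemma AnalyticAt.eventually_nonpos_or_eventually_pos {g : ℝ → ℝ} {a : ℝ}
    (hg : AnalyticAt ℝ g a) :
    (∀ᶠ t in nhdsWithin a (Set.Ioi a), g t ≤ 0) ∨ ∀ᶠ t in nhdsWithin a (Set.Ioi a), 0 < g t := by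
  by_cases h : ∀ᶠ t in nhds a, g t = 0
  · exact Or.inl ((h.filter_mono nhdsWithin_le_nhds).mono fun t ht => ht.le)
  obtain ⟨n, k, hk, hk0, hgk⟩ := hg.exists_eventuallyEq_pow_smul_nonzero_iff.2 h
  replace hgk := hgk.filter_mono (nhdsWithin_le_nhds (s := Set.Ioi a))
  rcases hk0.lt_or_gt with h0 | h0
  · left
    filter_upwards [hgk, self_mem_nhdsWithin,
      (hk.continuousAt.eventually_lt_const h0).filter_mono nhdsWithin_le_nhds] with t ht hta hkt
    rw [ht]
    exact mul_nonpos_of_nonneg_of_nonpos (pow_nonneg (sub_pos.2 hta).le n) hkt.le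
  · right
    filter_upwards [hgk, self_mem_nhdsWithin,
      (hk.continuousAt.eventually_const_lt h0).filter_mono nhdsWithin_le_nhds] with t ht hta hkt
    rw [ht]
    exact mul_pos (pow_pos (sub_pos.2 hta) n) hkt

section PolicyImprovement

variable {E : Type*} [Fintype E] {β : ℝ}

/-- Maximum principle for supersolutions of the linear discounted recursion. -/
lemma nonneg_of_discounted_superharmonic {p : E → E → ℝ} {r : E → ℝ} (hp0 : ∀ x y, 0 ≤ p x y)
    (hp : ∀ x, ∑ y, p x y = 1) (hβ : β ∈ Set.Ioo (0 : ℝ) 1) {D : E → ℝ → ℝ}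
    (hD0 : ∀ x, Tendsto (D x) (nhdsWithin 0 (Set.Ioi 0)) (nhds 0)) {ε : ℝ}
    (hD : ∀ x, ∀ t ∈ Set.Ioo 0 ε, exp (t * r x) * ∑ y, p x y * D y (β * t) ≤ D x t)
    {x : E} {t : ℝ} (ht : t ∈ Set.Ioo 0 ε) : 0 ≤ D x t := by
  obtain ⟨M, hM'⟩ := (Set.finite_range fun x => |r x|).bddAbove
  have hM : ∀ x, |r x| ≤ M := fun x => hM' ⟨x, rfl⟩
  have hβ' : 0 < 1 - β := sub_pos.2 hβ.2
  have key : ∀ n : ℕ, ∀ δ, 0 ≤ δ → ∀ t ∈ Set.Ioo 0 ε, (∀ y, -δ ≤ D y (β ^ n * t)) →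
      ∀ x, -(exp (M * t / (1 - β)) * δ) ≤ D x t := by
    intro n
    induction n with
    | zero =>
      intro δ hδ t ht h x
      have hM0 : 0 ≤ M := (abs_nonneg _).trans (hM x)
      have h1 : 1 ≤ exp (M * t / (1 - β)) :=
        one_le_exp (div_nonneg (mul_nonneg hM0 ht.1.le) hβ'.le)
      have h2 := h x
      rw [pow_zero, one_mul] at h2
      nlinarith
    | succ n ih =>
      intro δ hδ t ht h x
      have hβt : β * t ∈ Set.Ioo 0 ε :=
        ⟨mul_pos hβ.1 ht.1, (mul_lt_of_lt_one_left ht.1 hβ.2).trans ht.2⟩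
      have h1 := ih δ hδ (β * t) hβt fun y => by
        have := h y
        rwa [pow_succ, mul_assoc] at this
      set B := exp (M * (β * t) / (1 - β)) * δ with hB
      have hB0 : 0 ≤ B := by positivity
      have h2 : -B ≤ ∑ y, p x y * D y (β * t) := by
        calc -B = ∑ y, p x y * -B := by rw [← Finset.sum_mul, hp, one_mul]
          _ ≤ _ := Finset.sum_le_sum fun y _ => mul_le_mul_of_nonneg_left (h1 y) (hp0 x y)
      have h3 : exp (t * r x) ≤ exp (M * t) := by
        rw [exp_le_exp, mul_comm]
        exact mul_le_mul_of_nonneg_right ((le_abs_self _).trans (hM x)) ht.1.le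
      have h4 : exp (M * t / (1 - β)) * δ = exp (M * t) * B := by
        rw [hB, ← mul_assoc, ← exp_add]
        congr 2
        field_simp
        ring
      rw [h4]
      refine le_trans ?_ (hD x t ht)
      calc -(exp (M * t) * B) ≤ -(exp (t * r x) * B) :=
            neg_le_neg (mul_le_mul_of_nonneg_right h3 hB0)
        _ = exp (t * r x) * -B := by ring
        _ ≤ _ := mul_le_mul_of_nonneg_left h2 (exp_pos _).le
  have hpow : Tendsto (fun n : ℕ => β ^ n * t) atTop (nhdsWithin 0 (Set.Ioi 0)) := by
    refine tendsto_nhdsWithin_iff.2 ⟨?_, Eventually.of_forall fun n =>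
      mul_pos (pow_pos hβ.1 n) ht.1⟩
    simpa using (tendsto_pow_atTop_nhds_zero_of_lt_one hβ.1.le hβ.2).mul_const t
  have hsum : Tendsto (fun n : ℕ => -(exp (M * t / (1 - β)) * ∑ y, |D y (β ^ n * t)|)) atTop
      (nhds 0) := by
    have h : Tendsto (fun n : ℕ => ∑ y, |D y (β ^ n * t)|) atTop (nhds (∑ _y : E, 0)) :=
      tendsto_finsetSum _ fun y _ => by simpa using ((hD0 y).comp hpow).abs
    simpa using (h.const_mul (exp (M * t / (1 - β)))).neg
  refine le_of_tendsto' hsum fun n => key n _ (Finset.sum_nonneg fun y _ => abs_nonneg _) t ht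
    (fun y => ?_) x
  exact (neg_le_neg (Finset.single_le_sum (f := fun y => |D y (β ^ n * t)|)
    (fun y _ => abs_nonneg _) (Finset.mem_univ y))).trans (neg_abs_le _)

variable {U : Type*} [Fintype U] [Nonempty U] {P : U → E → E → ℝ}

/-- For all sufficiently small risk parameters one and the same stationary policy is optimal;
the sign of `s` determines whether expectations are maximized or minimized. -/
lemma exists_stationary_optimal_near_zero (hP : IsStochastic P) (hβ : β ∈ Set.Ioo (0 : ℝ) 1)
    (r : E → U → ℝ) (s : ℝ) :
    ∃ (u : E → U) (f : E → ℝ → ℝ),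
      (∀ x, Tendsto (f x) (nhdsWithin 0 (Set.Ioi 0)) (nhds 1)) ∧
      (∀ x t, f x t = exp (t * r x (u x)) * ∑ y, P (u x) x y * f y (β * t)) ∧
      ∀ᶠ t in nhdsWithin 0 (Set.Ioi 0), ∀ x a,
        s * (exp (t * r x a) * ∑ y, P a x y * f y (β * t)) ≤ s * f x t := by
  classical
  choose f hfan hf0 hf using fun u : E → U =>
    exists_analyticAt_stationaryValue (p := fun x => P (u x) x) (fun x => hP.1 (u x) x)
      (fun x => hP.2 (u x) x) hβ fun x => r x (u x)
  have hlim : ∀ u x, Tendsto (f u x) (nhdsWithin 0 (Set.Ioi 0)) (nhds 1) := fun u x => by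
    have := (hfan u x).continuousAt.tendsto
    rw [hf0] at this
    exact this.mono_left nhdsWithin_le_nhds
  obtain ⟨u, -, hu⟩ := Set.finite_univ.exists_maximalFor
    (fun u : E → U => (↑(fun t x => s * f u x t) : Germ (nhdsWithin (0 : ℝ) (Set.Ioi 0)) (E → ℝ)))
    Set.univ Set.univ_nonempty
  have hmax : ∀ v, (∀ᶠ t in nhdsWithin 0 (Set.Ioi 0), ∀ x, s * f u x t ≤ s * f v x t) →
      ∀ᶠ t in nhdsWithin 0 (Set.Ioi 0), ∀ x, s * f v x t ≤ s * f u x t :=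
    fun v hv => Germ.coe_le.1 (hu (Set.mem_univ v) (Germ.coe_le.2 hv))
  refine ⟨u, f u, hlim u, hf u, ?_⟩
  rw [eventually_all]
  intro x
  rw [eventually_all]
  intro a
  have hmul : AnalyticAt ℝ (fun t : ℝ => β * t) 0 := analyticAt_const.mul analyticAt_id
  have hfβ : ∀ y, AnalyticAt ℝ (fun t => f u y (β * t)) 0 := fun y =>
    AnalyticAt.fun_comp (by simpa using hfan u y) hmul
  have hgan : AnalyticAt ℝ (fun t =>
      s * (exp (t * r x a) * ∑ y, P a x y * f u y (β * t)) - s * f u x t) 0 := by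
    refine (analyticAt_const.mul (((analyticAt_id.mul analyticAt_const).rexp').mul
      (Finset.analyticAt_fun_sum _ fun y _ => analyticAt_const.mul (hfβ y)))).sub
      (analyticAt_const.mul (hfan u x))
  rcases hgan.eventually_nonpos_or_eventually_pos with h | h
  · exact h.mono fun t ht => sub_nonpos.1 ht
  exfalso
  set v := Function.update u x a with hv
  have hvx : v x = a := Function.update_self ..
  obtain ⟨ε, hε, hpos⟩ := mem_nhdsGT_iff_exists_Ioo_subset.1 h
  have himp : ∀ z, ∀ t ∈ Set.Ioo 0 ε,
      s * f u z t ≤ s * (exp (t * r z (v z)) * ∑ y, P (v z) z y * f u y (β * t)) := by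
    intro z t ht
    by_cases hz : z = x
    · rw [hz, hvx]
      exact (sub_pos.1 (hpos ht)).le
    · have hvz : v z = u z := Function.update_of_ne hz ..
      rw [hvz, ← hf u]
  have hdist : ∀ z t, exp (t * r z (v z)) *
      ∑ y, P (v z) z y * (s * f v y (β * t) - s * f u y (β * t)) =
      s * f v z t - s * (exp (t * r z (v z)) * ∑ y, P (v z) z y * f u y (β * t)) := by
    intro z t
    simp only [hf v z t, mul_sub, Finset.sum_sub_distrib, Finset.mul_sum, mul_left_comm s]
  have hnonneg : ∀ z, ∀ t ∈ Set.Ioo 0 ε, 0 ≤ s * f v z t - s * f u z t := fun z t ht => by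
    refine nonneg_of_discounted_superharmonic (D := fun z t => s * f v z t - s * f u z t)
      (fun x => hP.1 (v x) x) (fun x => hP.2 (v x) x) hβ (r := fun z => r z (v z)) (fun z => ?_)
      (fun z t ht => ?_) ht
    · simpa using ((hlim v z).const_mul s).sub ((hlim u z).const_mul s)
    · rw [hdist]
      exact sub_le_sub_left (himp z t ht) _
  have hmem : Set.Ioo 0 ε ∈ nhdsWithin (0 : ℝ) (Set.Ioi 0) := Ioo_mem_nhdsGT hε
  have hle := hmax v (mem_of_superset hmem fun t ht z => sub_nonneg.1 (hnonneg z t ht))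
  obtain ⟨t, ht, htε⟩ := (hle.and hmem).exists
  have hβt : β * t ∈ Set.Ioo 0 ε :=
    ⟨mul_pos hβ.1 htε.1, (mul_lt_of_lt_one_left htε.1 hβ.2).trans htε.2⟩
  have h1 := hdist x t
  have h2 : 0 ≤ exp (t * r x (v x)) *
      ∑ y, P (v x) x y * (s * f v y (β * t) - s * f u y (β * t)) :=
    mul_nonneg (exp_pos _).le
      (Finset.sum_nonneg fun y _ => mul_nonneg (hP.1 _ _ _) (hnonneg y _ hβt))
  have h3 : s * f u x t < s * (exp (t * r x a) * ∑ y, P a x y * f u y (β * t)) :=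
    sub_pos.1 (hpos htε)
  rw [hvx] at h1 h2
  linarith [ht x]

/-- Backward induction extends a solution of the Bellman recursion from times `n ≥ N` to all
times. -/
lemma exists_bellman_extension (r : ℕ → E → U → ℝ) (s : ℝ) (N : ℕ) (V : ℕ → E → ℝ)
    (us : ℕ → E → U)
    (hB : ∀ n ≥ N, ∀ x a, s * (exp (r n x a) * ∑ y, P a x y * V (n + 1) y) ≤ s * V n x)
    (hus : ∀ n ≥ N, ∀ x, exp (r n x (us n x)) * ∑ y, P (us n x) x y * V (n + 1) y = V n x) :
    ∃ (V' : ℕ → E → ℝ) (us' : ℕ → E → U),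
      (∀ n ≥ N, V' n = V n) ∧ (∀ n ≥ N, us' n = us n) ∧
      (∀ n x a, s * (exp (r n x a) * ∑ y, P a x y * V' (n + 1) y) ≤ s * V' n x) ∧
      ∀ n x, exp (r n x (us' n x)) * ∑ y, P (us' n x) x y * V' (n + 1) y = V' n x := by
  induction N generalizing V us with
  | zero =>
    exact ⟨V, us, fun _ _ => rfl, fun _ _ => rfl, fun n => hB n n.zero_le,
      fun n => hus n n.zero_le⟩
  | succ N ih =>
    choose u hu using fun x => Finite.exists_max fun a =>
      s * (exp (r N x a) * ∑ y, P a x y * V (N + 1) y)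
    set W : E → ℝ := fun x => exp (r N x (u x)) * ∑ y, P (u x) x y * V (N + 1) y with hW
    have hne : ∀ n ≥ N + 1, n ≠ N := fun n hn => by omega
    have hV : ∀ n ≥ N + 1, Function.update V N W n = V n := fun n hn =>
      Function.update_of_ne (hne n hn) ..
    have hU : ∀ n ≥ N + 1, Function.update us N u n = us n := fun n hn =>
      Function.update_of_ne (hne n hn) ..
    obtain ⟨V', us', h1, h2, h3, h4⟩ := ih (Function.update V N W) (Function.update us N u)
      (fun n hn x a => by
        rw [hV (n + 1) (by omega)]
        rcases hn.eq_or_lt with rfl | hlt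
        · rw [Function.update_self]
          exact hu x a
        · rw [hV n hlt]
          exact hB n hlt x a)
      (fun n hn x => by
        rw [hV (n + 1) (by omega)]
        rcases hn.eq_or_lt with rfl | hlt
        · rw [Function.update_self, Function.update_self]
        · rw [hV n hlt, hU n hlt]
          exact hus n hlt x)
    exact ⟨V', us', fun n hn => (h1 n (by omega)).trans (hV n hn),
      fun n hn => (h2 n (by omega)).trans (hU n hn), h3, h4⟩

end PolicyImprovement

/-- under condition (C), for `β ∈ (0,1)` and `γ ≠ 0`, there exists a
`β`-discount optimal Markov policy which is ultimately stationary: it follows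
`u₀, …, u_{N-1}` for the first `N` steps and a fixed `u` afterwards. -/
theorem exists_ultimately_stationary_discount_optimal
    {E U : Type*} [Fintype E] [DecidableEq E] [Fintype U] [Nonempty E] [Nonempty U]
    (P : U → E → E → ℝ) (c : E → U → ℝ) (β γ : ℝ)
    (hP : IsStochastic P) (hC : CondC P) (hβ : β ∈ Set.Ioo (0 : ℝ) 1) (hγ : γ ≠ 0) :
    ∃ (N : ℕ) (us : ℕ → E → U) (u : E → U),
      (∀ n : ℕ, N ≤ n → us n = u) ∧
      ∀ x : E,
        Jdisc P c γ x (markovPolicy us) β = ⨆ pol : Policy E U, Jdisc P c γ x pol β := by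
  obtain ⟨u, f, hlim, hfix, hopt⟩ :=
    exists_stationary_optimal_near_zero hP hβ (fun x a => γ * c x a) γ
  have hpow : Tendsto (fun n : ℕ => β ^ n) atTop (nhdsWithin 0 (Set.Ioi 0)) :=
    tendsto_nhdsWithin_iff.2 ⟨tendsto_pow_atTop_nhds_zero_of_lt_one hβ.1.le hβ.2,
      Eventually.of_forall fun n => pow_pos hβ.1 n⟩
  obtain ⟨N, hN⟩ := eventually_atTop.1 (hpow.eventually hopt)
  obtain ⟨V, us, hV, hus, hB, heq⟩ := exists_bellman_extension (P := P)
    (fun n x a => β ^ n * (γ * c x a)) γ N (fun n x => f x (β ^ n)) (fun _ => u)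
    (fun n hn x a => by simpa only [pow_succ'] using hN n hn x a)
    (fun n _ x => by simpa only [pow_succ'] using (hfix x (β ^ n)).symm)
  refine ⟨N, us, u, hus, Jdisc_markovPolicy_eq_iSup hP hβ hγ (V := V) (fun x => ?_) hB heq⟩
  refine ((hlim x).comp hpow).congr' ?_
  filter_upwards [eventually_ge_atTop N] with n hn
  rw [hV n hn]
  rfl
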